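/- arXiv:2103.03507 — 3 statements merged into one kernel-verified Lean document; each statement's English description precedes it below -/
import Mathlib

section
/- Let the digraph be strongly connected and weight-balanced and let α, β > 0. Define the symmetric positive semidefinite matrix Q11 = (1/2)α(𝐋 + 𝐋ᵀ) + β𝒜ᵀ𝟙_m𝟙_mᵀ𝒜. Then a vector w ∈ ℝ^{mn} satisfies Q11 w = 0 if and only if 𝐋ᵀ w = 0 and 𝟙_mᵀ𝒜 w = 0, which holds if and only if w = 𝟙_n ⊗ w₀ for some w₀ ∈ ℝ^m with A w₀ = 0. -/
open Matrix

noncomputable section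

/-- Laplacian `L = D^in − Adj`, where `D^in` is the diagonal matrix of weighted
in-degrees (column sums of `Adj`). -/
def lap {n : ℕ} (Adj : Matrix (Fin n) (Fin n) ℝ) : Matrix (Fin n) (Fin n) ℝ :=
  Matrix.diagonal (fun i => ∑ j, Adj j i) - Adj

/-- Strong connectivity: there is a directed path between any two distinct
vertices, where there is an edge from `i` to `j` iff `Adj i j > 0`. -/
def StronglyConnected {n : ℕ} (Adj : Matrix (Fin n) (Fin n) ℝ) : Prop :=
  ∀ i j : Fin n, i ≠ j → Relation.TransGen (fun a b => 0 < Adj a b) i j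

/-- Weight-balanced: `L 𝟙 = 0`. -/
def WeightBalanced {n : ℕ} (Adj : Matrix (Fin n) (Fin n) ℝ) : Prop :=
  (lap Adj).mulVec (fun _ => (1 : ℝ)) = 0

/-- `𝐋 = L ⊗ I_m`. -/
def bigL (m : ℕ) {n : ℕ} (Adj : Matrix (Fin n) (Fin n) ℝ) :
    Matrix (Fin n × Fin m) (Fin n × Fin m) ℝ :=
  Matrix.kroneckerMap (· * ·) (lap Adj) (1 : Matrix (Fin m) (Fin m) ℝ)

/-- `𝒜 = blockdiag(A_1, …, A_n)`. -/
def blkDiag {n m : ℕ} (A : Fin n → Matrix (Fin m) (Fin m) ℝ) :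
    Matrix (Fin n × Fin m) (Fin n × Fin m) ℝ :=
  fun p q => if p.1 = q.1 then A p.1 p.2 q.2 else 0

/-- `𝟙_m = 𝟙_n ⊗ I_m`. -/
def onesM (n m : ℕ) : Matrix (Fin n × Fin m) (Fin m) ℝ :=
  fun p j => if p.2 = j then 1 else 0

/-- The consensus vector `𝟙_n ⊗ x`. -/
def consensus (n : ℕ) {m : ℕ} (x : Fin m → ℝ) : Fin n × Fin m → ℝ := fun p => x p.2

/-- `Q11 = (1/2)α(𝐋 + 𝐋ᵀ) + β𝒜ᵀ𝟙_m𝟙_mᵀ𝒜`. -/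
def matQ11 {n m : ℕ} (Adj : Matrix (Fin n) (Fin n) ℝ)
    (A : Fin n → Matrix (Fin m) (Fin m) ℝ) (α β : ℝ) :
    Matrix (Fin n × Fin m) (Fin n × Fin m) ℝ :=
  (α / 2) • (bigL m Adj + (bigL m Adj)ᵀ)
    + β • ((blkDiag A)ᵀ * onesM n m * (onesM n m)ᵀ * blkDiag A)

theorem WeightBalanced.sum_row_eq_sum_col {n : ℕ} {Adj : Matrix (Fin n) (Fin n) ℝ}
    (h : WeightBalanced Adj) (i : Fin n) : ∑ j, Adj i j = ∑ j, Adj j i := by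
  have h1 := congrFun h i
  simp only [lap, sub_mulVec, mulVec_diagonal, Pi.sub_apply, Pi.zero_apply, mul_one] at h1
  simp only [mulVec, dotProduct, mul_one] at h1
  linarith

theorem WeightBalanced.two_mul_dotProduct_lap {n : ℕ} {Adj : Matrix (Fin n) (Fin n) ℝ}
    (h : WeightBalanced Adj) (v : Fin n → ℝ) :
    2 * (v ⬝ᵥ lap Adj *ᵥ v) = ∑ i, ∑ j, Adj i j * (v i - v j) ^ 2 := by
  have hL : v ⬝ᵥ lap Adj *ᵥ v =
      ∑ i, (∑ j, Adj j i) * v i ^ 2 - ∑ i, ∑ j, Adj i j * (v i * v j) := by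
    rw [lap, sub_mulVec, dotProduct_sub]
    simp only [dotProduct, mulVec_diagonal]
    congr 1
    · exact Finset.sum_congr rfl fun i _ => by ring
    · simp only [mulVec, dotProduct, Finset.mul_sum]
      exact Finset.sum_congr rfl fun i _ => Finset.sum_congr rfl fun j _ => by ring
  have hcol : ∑ i, ∑ j, Adj i j * v j ^ 2 = ∑ i, (∑ j, Adj j i) * v i ^ 2 := by
    rw [Finset.sum_comm]
    simp only [Finset.sum_mul]
  have hrow : ∑ i, ∑ j, Adj i j * v i ^ 2 = ∑ i, (∑ j, Adj j i) * v i ^ 2 := by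
    refine Finset.sum_congr rfl fun i _ => ?_
    rw [← Finset.sum_mul, h.sum_row_eq_sum_col]
  have hexp : ∑ i, ∑ j, Adj i j * (v i - v j) ^ 2 =
      ∑ i, ∑ j, Adj i j * v i ^ 2 + ∑ i, ∑ j, Adj i j * v j ^ 2
        - 2 * ∑ i, ∑ j, Adj i j * (v i * v j) := by
    simp only [Finset.mul_sum, ← Finset.sum_add_distrib, ← Finset.sum_sub_distrib]
    exact Finset.sum_congr rfl fun i _ => Finset.sum_congr rfl fun j _ => by ring
  rw [hexp, hcol, hrow, hL]
  ring

theorem WeightBalanced.dotProduct_lap_nonneg {n : ℕ} {Adj : Matrix (Fin n) (Fin n) ℝ}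
    (h : WeightBalanced Adj) (hAdj : ∀ i j, 0 ≤ Adj i j) (v : Fin n → ℝ) :
    0 ≤ v ⬝ᵥ lap Adj *ᵥ v := by
  have h1 : 0 ≤ ∑ i, ∑ j, Adj i j * (v i - v j) ^ 2 :=
    Finset.sum_nonneg fun i _ => Finset.sum_nonneg fun j _ => mul_nonneg (hAdj i j) (sq_nonneg _)
  linarith [h.two_mul_dotProduct_lap v]

theorem WeightBalanced.eq_of_dotProduct_lap_eq_zero {n : ℕ} {Adj : Matrix (Fin n) (Fin n) ℝ}
    (h : WeightBalanced Adj) (hAdj : ∀ i j, 0 ≤ Adj i j) (hSC : StronglyConnected Adj)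
    {v : Fin n → ℝ} (hv : v ⬝ᵥ lap Adj *ᵥ v = 0) (i j : Fin n) : v i = v j := by
  have hnn : ∀ i j, 0 ≤ Adj i j * (v i - v j) ^ 2 :=
    fun i j => mul_nonneg (hAdj i j) (sq_nonneg _)
  have hsum := h.two_mul_dotProduct_lap v
  rw [hv, mul_zero] at hsum
  have hedge : ∀ a b, 0 < Adj a b → v a = v b := by
    intro a b hab
    have h1 := (Finset.sum_eq_zero_iff_of_nonneg fun i _ =>
      Finset.sum_nonneg fun j _ => hnn i j).1 hsum.symm a (Finset.mem_univ a)
    have h2 := (Finset.sum_eq_zero_iff_of_nonneg fun j _ => hnn a j).1 h1 b (Finset.mem_univ b)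
    have h3 := (mul_eq_zero.1 h2).resolve_left hab.ne'
    exact sub_eq_zero.1 (pow_eq_zero_iff two_ne_zero |>.1 h3)
  by_cases hij : i = j
  · rw [hij]
  · have hpath := hSC i j hij
    induction hpath with
    | single hab => exact hedge _ _ hab
    | @tail b c _ hbc ih =>
      by_cases hib : i = b
      · rw [hib]; exact hedge _ _ hbc
      · rw [ih hib, hedge _ _ hbc]

theorem bigL_mulVec {n m : ℕ} (Adj : Matrix (Fin n) (Fin n) ℝ) (w : Fin n × Fin m → ℝ)
    (p : Fin n × Fin m) :
    (bigL m Adj *ᵥ w) p = (lap Adj *ᵥ fun i => w (i, p.2)) p.1 := by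
  simp [bigL, mulVec, dotProduct, Fintype.sum_prod_type, one_apply]

theorem bigL_transpose_mulVec {n m : ℕ} (Adj : Matrix (Fin n) (Fin n) ℝ)
    (w : Fin n × Fin m → ℝ) (p : Fin n × Fin m) :
    ((bigL m Adj)ᵀ *ᵥ w) p = ((lap Adj)ᵀ *ᵥ fun i => w (i, p.2)) p.1 := by
  simp [bigL, mulVec, dotProduct, Fintype.sum_prod_type, one_apply]

theorem dotProduct_bigL_mulVec {n m : ℕ} (Adj : Matrix (Fin n) (Fin n) ℝ)
    (w : Fin n × Fin m → ℝ) :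
    w ⬝ᵥ bigL m Adj *ᵥ w =
      ∑ k, (fun i => w (i, k)) ⬝ᵥ lap Adj *ᵥ fun i => w (i, k) := by
  simp only [dotProduct, bigL_mulVec, Fintype.sum_prod_type]
  exact Finset.sum_comm

theorem dotProduct_transpose_mulVec_self {ι : Type*} [Fintype ι] (M : Matrix ι ι ℝ)
    (w : ι → ℝ) : w ⬝ᵥ Mᵀ *ᵥ w = w ⬝ᵥ M *ᵥ w := by
  rw [mulVec_transpose, dotProduct_comm, dotProduct_mulVec]

theorem lap_transpose_mulVec_const {n : ℕ} (Adj : Matrix (Fin n) (Fin n) ℝ) (c : ℝ) :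
    (lap Adj)ᵀ *ᵥ (fun _ => c) = 0 := by
  ext i
  rw [lap, transpose_sub, diagonal_transpose, sub_mulVec, Pi.sub_apply, mulVec_diagonal]
  simp [mulVec, dotProduct, Finset.sum_mul]

theorem WeightBalanced.lap_mulVec_const {n : ℕ} {Adj : Matrix (Fin n) (Fin n) ℝ}
    (h : WeightBalanced Adj) (c : ℝ) : lap Adj *ᵥ (fun _ => c) = 0 := by
  have hc : (fun _ : Fin n => c) = c • fun _ => (1 : ℝ) := by ext; simp
  rw [hc, mulVec_smul, show lap Adj *ᵥ (fun _ => (1 : ℝ)) = 0 from h, smul_zero]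

theorem WeightBalanced.bigL_mulVec_consensus {n m : ℕ} {Adj : Matrix (Fin n) (Fin n) ℝ}
    (h : WeightBalanced Adj) (x : Fin m → ℝ) : bigL m Adj *ᵥ consensus n x = 0 := by
  ext p
  rw [bigL_mulVec]
  exact congrFun (h.lap_mulVec_const (x p.2)) p.1

theorem bigL_transpose_mulVec_consensus {n m : ℕ} (Adj : Matrix (Fin n) (Fin n) ℝ)
    (x : Fin m → ℝ) : (bigL m Adj)ᵀ *ᵥ consensus n x = 0 := by
  ext p
  rw [bigL_transpose_mulVec]
  exact congrFun (lap_transpose_mulVec_const Adj (x p.2)) p.1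

theorem WeightBalanced.dotProduct_bigL_nonneg {n m : ℕ} {Adj : Matrix (Fin n) (Fin n) ℝ}
    (h : WeightBalanced Adj) (hAdj : ∀ i j, 0 ≤ Adj i j) (w : Fin n × Fin m → ℝ) :
    0 ≤ w ⬝ᵥ bigL m Adj *ᵥ w := by
  rw [dotProduct_bigL_mulVec]
  exact Finset.sum_nonneg fun k _ => h.dotProduct_lap_nonneg hAdj _

theorem WeightBalanced.exists_eq_consensus {n m : ℕ} {Adj : Matrix (Fin n) (Fin n) ℝ}
    (h : WeightBalanced Adj) (hn : 0 < n) (hAdj : ∀ i j, 0 ≤ Adj i j)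
    (hSC : StronglyConnected Adj) {w : Fin n × Fin m → ℝ} (hw : w ⬝ᵥ bigL m Adj *ᵥ w = 0) :
    ∃ x : Fin m → ℝ, w = consensus n x := by
  rw [dotProduct_bigL_mulVec,
    Finset.sum_eq_zero_iff_of_nonneg fun k _ => h.dotProduct_lap_nonneg hAdj _] at hw
  refine ⟨fun k => w (⟨0, hn⟩, k), ?_⟩
  ext ⟨i, k⟩
  exact h.eq_of_dotProduct_lap_eq_zero hAdj hSC (hw k (Finset.mem_univ k)) i ⟨0, hn⟩

theorem onesM_transpose_mul_blkDiag_mulVec_consensus {n m : ℕ}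
    (A : Fin n → Matrix (Fin m) (Fin m) ℝ) (x : Fin m → ℝ) :
    ((onesM n m)ᵀ * blkDiag A) *ᵥ consensus n x = (∑ i, A i) *ᵥ x := by
  ext k
  simp only [mulVec, dotProduct, mul_apply, transpose_apply, onesM, blkDiag, consensus,
    Fintype.sum_prod_type, Matrix.sum_apply]
  simp only [Finset.sum_mul, ite_mul, one_mul, zero_mul, Finset.sum_ite_eq',
    Finset.mem_univ, if_true]
  exact Finset.sum_comm

theorem matQ11_mulVec {n m : ℕ} (Adj : Matrix (Fin n) (Fin n) ℝ)
    (A : Fin n → Matrix (Fin m) (Fin m) ℝ) (α β : ℝ) (w : Fin n × Fin m → ℝ) :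
    matQ11 Adj A α β *ᵥ w =
      (α / 2) • (bigL m Adj *ᵥ w + (bigL m Adj)ᵀ *ᵥ w) +
        β • (((onesM n m)ᵀ * blkDiag A)ᵀ *ᵥ (((onesM n m)ᵀ * blkDiag A) *ᵥ w)) := by
  simp only [matQ11, add_mulVec, smul_mulVec, mulVec_mulVec, transpose_mul, transpose_transpose,
    Matrix.mul_assoc]

theorem dotProduct_matQ11_mulVec {n m : ℕ} (Adj : Matrix (Fin n) (Fin n) ℝ)
    (A : Fin n → Matrix (Fin m) (Fin m) ℝ) (α β : ℝ) (w : Fin n × Fin m → ℝ) :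
    w ⬝ᵥ matQ11 Adj A α β *ᵥ w =
      α * (w ⬝ᵥ bigL m Adj *ᵥ w) +
        β * ((((onesM n m)ᵀ * blkDiag A) *ᵥ w) ⬝ᵥ (((onesM n m)ᵀ * blkDiag A) *ᵥ w)) := by
  rw [matQ11_mulVec, dotProduct_add, dotProduct_smul, dotProduct_smul, dotProduct_add,
    dotProduct_transpose_mulVec_self, dotProduct_mulVec w (_ᵀ), vecMul_transpose,
    smul_eq_mul, smul_eq_mul]
  ring

/-- over a strongly connected weight-balanced digraph, for `α, β > 0`,
with `Q11 = (1/2)α(𝐋 + 𝐋ᵀ) + β𝒜ᵀ𝟙_m𝟙_mᵀ𝒜`: `Q11 w = 0` iff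
`𝐋ᵀw = 0 ∧ 𝟙_mᵀ𝒜w = 0`, which holds iff `w = 𝟙_n ⊗ w₀` with `Aw₀ = 0`. -/
theorem stmt3 {n m : ℕ} (hn : 2 ≤ n)
    (Adj : Matrix (Fin n) (Fin n) ℝ) (hAdj : ∀ i j, 0 ≤ Adj i j)
    (hSC : StronglyConnected Adj) (hWB : WeightBalanced Adj)
    (A : Fin n → Matrix (Fin m) (Fin m) ℝ)
    (α β : ℝ) (hα : 0 < α) (hβ : 0 < β) :
    ∀ w : Fin n × Fin m → ℝ,
      ((matQ11 Adj A α β).mulVec w = 0 ↔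
        ((bigL m Adj)ᵀ.mulVec w = 0 ∧ ((onesM n m)ᵀ * blkDiag A).mulVec w = 0)) ∧
      ((matQ11 Adj A α β).mulVec w = 0 ↔
        (∃ w0 : Fin m → ℝ, (∑ i, A i).mulVec w0 = 0 ∧ w = consensus n w0)) := by
  intro w
  have hn0 : 0 < n := by omega
  have hcons : ∀ x : Fin m → ℝ, (∑ i, A i) *ᵥ x = 0 →
      matQ11 Adj A α β *ᵥ consensus n x = 0 := by
    intro x hx
    rw [matQ11_mulVec, hWB.bigL_mulVec_consensus, bigL_transpose_mulVec_consensus,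
      onesM_transpose_mul_blkDiag_mulVec_consensus, hx]
    simp
  have hker : matQ11 Adj A α β *ᵥ w = 0 →
      ∃ x : Fin m → ℝ, (∑ i, A i) *ᵥ x = 0 ∧ w = consensus n x := by
    intro hQ
    have hquad := dotProduct_matQ11_mulVec Adj A α β w
    rw [hQ, dotProduct_zero] at hquad
    have hL := mul_nonneg hα.le (hWB.dotProduct_bigL_nonneg hAdj w)
    have hB := mul_nonneg hβ.le (Finset.sum_nonneg fun k (_ : k ∈ Finset.univ) =>
      mul_self_nonneg ((((onesM n m)ᵀ * blkDiag A) *ᵥ w) k))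
    rw [← dotProduct] at hB
    have hL0 : w ⬝ᵥ bigL m Adj *ᵥ w = 0 :=
      (mul_eq_zero.1 (by linarith : α * (w ⬝ᵥ bigL m Adj *ᵥ w) = 0)).resolve_left hα.ne'
    have hB0 : ((onesM n m)ᵀ * blkDiag A) *ᵥ w = 0 := by
      rw [hL0, mul_zero, zero_add] at hquad
      exact dotProduct_self_eq_zero.1 ((mul_eq_zero.1 hquad.symm).resolve_left hβ.ne')
    obtain ⟨x, rfl⟩ := hWB.exists_eq_consensus hn0 hAdj hSC hL0
    exact ⟨x, by rwa [onesM_transpose_mul_blkDiag_mulVec_consensus] at hB0, rfl⟩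
  refine ⟨⟨fun hQ => ?_, fun ⟨hLT, hB⟩ => ?_⟩, hker, ?_⟩
  · obtain ⟨x, hx, rfl⟩ := hker hQ
    exact ⟨bigL_transpose_mulVec_consensus Adj x,
      by rw [onesM_transpose_mul_blkDiag_mulVec_consensus, hx]⟩
  · have hL0 : w ⬝ᵥ bigL m Adj *ᵥ w = 0 := by
      rw [← dotProduct_transpose_mulVec_self, hLT, dotProduct_zero]
    obtain ⟨x, rfl⟩ := hWB.exists_eq_consensus hn0 hAdj hSC hL0
    rw [onesM_transpose_mul_blkDiag_mulVec_consensus] at hB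
    exact hcons x hB
  · rintro ⟨x, hx, rfl⟩
    exact hcons x hx
end
end

section
/- (Lemma 2) Let the digraph be strongly connected and weight-balanced and let α, β, γ > 0. (i) If (x*, 0) ∈ ℝ^{mn} × ℝ^{mn} is an equilibrium of the distributed dynamics ẋ = −α𝐋x − nβ𝒜ᵀy, ẏ = −α𝒜𝐋x − nβ𝒜𝒜ᵀy − γ𝐋y, then x* = 𝟙_n ⊗ x̂ for some x̂ ∈ ℝ^m. (ii) Along every trajectory (x(t), y(t)) of these dynamics, the quantity 𝟙_mᵀ(y(t) − 𝒜x(t)) ∈ ℝ^m is constant in t. -/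
open Matrix

noncomputable section

/-- Right-hand side of the `x`-dynamics of the distributed algorithm:
`ẋ = −α𝐋x − nβ𝒜ᵀy`. -/
def rhsX {n m : ℕ} (Adj : Matrix (Fin n) (Fin n) ℝ)
    (A : Fin n → Matrix (Fin m) (Fin m) ℝ) (α β : ℝ)
    (x y : Fin n × Fin m → ℝ) : Fin n × Fin m → ℝ :=
  -(α • (bigL m Adj).mulVec x) - ((n : ℝ) * β) • (blkDiag A)ᵀ.mulVec y

/-- Right-hand side of the `y`-dynamics of the distributed algorithm:
`ẏ = −α𝒜𝐋x − nβ𝒜𝒜ᵀy − γ𝐋y`. -/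
def rhsY {n m : ℕ} (Adj : Matrix (Fin n) (Fin n) ℝ)
    (A : Fin n → Matrix (Fin m) (Fin m) ℝ) (α β γ : ℝ)
    (x y : Fin n × Fin m → ℝ) : Fin n × Fin m → ℝ :=
  -(α • (blkDiag A * bigL m Adj).mulVec x)
    - ((n : ℝ) * β) • (blkDiag A * (blkDiag A)ᵀ).mulVec y
    - γ • (bigL m Adj).mulVec y

theorem WeightBalanced.sum_row_eq {n : ℕ} {Adj : Matrix (Fin n) (Fin n) ℝ}
    (h : WeightBalanced Adj) (i : Fin n) : ∑ j, Adj j i = ∑ j, Adj i j := by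
  have hi := congrFun h i
  simp only [lap, Matrix.sub_mulVec, Matrix.mulVec_diagonal, Pi.sub_apply, Pi.zero_apply] at hi
  simpa [Matrix.mulVec, dotProduct, sub_eq_zero] using hi

theorem WeightBalanced.lap_mulVec_apply {n : ℕ} {Adj : Matrix (Fin n) (Fin n) ℝ}
    (h : WeightBalanced Adj) (u : Fin n → ℝ) (i : Fin n) :
    (lap Adj).mulVec u i = ∑ j, Adj i j * (u i - u j) := by
  simp only [lap, Matrix.sub_mulVec, Matrix.mulVec_diagonal, Pi.sub_apply, h.sum_row_eq,
    mul_sub, Finset.sum_sub_distrib, Finset.sum_mul]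
  rfl

/-- Maximum principle: a vector in the kernel of the Laplacian of a strongly connected
weight-balanced digraph is constant. -/
theorem eq_of_lap_mulVec_eq_zero {n : ℕ} {Adj : Matrix (Fin n) (Fin n) ℝ}
    (hAdj : ∀ i j, 0 ≤ Adj i j) (hSC : StronglyConnected Adj) (hWB : WeightBalanced Adj)
    {u : Fin n → ℝ} (hu : (lap Adj).mulVec u = 0) (i j : Fin n) : u i = u j := by
  have : Nonempty (Fin n) := ⟨i⟩
  obtain ⟨k, hk⟩ := Finite.exists_max u
  have step : ∀ a b, u a = u k → 0 < Adj a b → u b = u k := by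
    intro a b ha hab
    have h0 : ∑ j, Adj a j * (u a - u j) = 0 := by
      rw [← hWB.lap_mulVec_apply, hu, Pi.zero_apply]
    rw [Finset.sum_eq_zero_iff_of_nonneg
      (fun j _ => mul_nonneg (hAdj a j) (sub_nonneg.2 (ha ▸ hk j)))] at h0
    have := (mul_eq_zero.1 (h0 b (Finset.mem_univ b))).resolve_left hab.ne'
    linarith
  have key : ∀ l, u l = u k := by
    intro l
    by_cases hl : k = l
    · rw [hl]
    · have hp := hSC k l hl
      clear hl
      induction hp with
      | single h => exact step _ _ rfl h
      | tail _ h ih => exact step _ _ ih h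
  rw [key i, key j]

theorem bigL_mulVec_apply {n : ℕ} (m : ℕ) (Adj : Matrix (Fin n) (Fin n) ℝ)
    (x : Fin n × Fin m → ℝ) (i : Fin n) (k : Fin m) :
    (bigL m Adj).mulVec x (i, k) = (lap Adj).mulVec (fun j => x (j, k)) i := by
  simp [bigL, Matrix.mulVec, dotProduct, Fintype.sum_prod_type, Matrix.one_apply]

/-- The columns of the Laplacian sum to zero: `𝟙ᵀ 𝐋 = 0`. -/
theorem onesM_transpose_mul_bigL {n : ℕ} (m : ℕ) (Adj : Matrix (Fin n) (Fin n) ℝ) :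
    (onesM n m)ᵀ * bigL m Adj = 0 := by
  ext k ⟨j, l⟩
  simp [Matrix.mul_apply, onesM, bigL, lap, Fintype.sum_prod_type, Matrix.one_apply,
    Matrix.diagonal_apply]

theorem rhsY_sub_blkDiag_mulVec_rhsX {n m : ℕ} (Adj : Matrix (Fin n) (Fin n) ℝ)
    (A : Fin n → Matrix (Fin m) (Fin m) ℝ) (α β γ : ℝ) (x y : Fin n × Fin m → ℝ) :
    rhsY Adj A α β γ x y - (blkDiag A).mulVec (rhsX Adj A α β x y) =
      -(γ • (bigL m Adj).mulVec y) := by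
  simp only [rhsX, rhsY, Matrix.mulVec_sub, Matrix.mulVec_neg, Matrix.mulVec_smul,
    Matrix.mulVec_mulVec]
  abel

theorem Matrix.hasDerivAt_mulVec {p q : Type*} [Fintype p] [Fintype q]
    (M : Matrix p q ℝ) {f : ℝ → q → ℝ} {f' : q → ℝ} {t : ℝ} (hf : HasDerivAt f f' t) :
    HasDerivAt (fun s => M.mulVec (f s)) (M.mulVec f') t :=
  (LinearMap.toContinuousLinearMap M.mulVecLin).hasFDerivAt.comp_hasDerivAt t hf

/-- Lemma 2: over a strongly connected weight-balanced digraph and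
`α, β, γ > 0`: (i) if `(x*, 0)` is an equilibrium of the distributed dynamics then
`x* = 𝟙_n ⊗ x̂` for some `x̂`; (ii) along every trajectory, `𝟙_mᵀ(y(t) − 𝒜x(t))`
is constant in `t`. -/
theorem stmt6 {n m : ℕ} (hn : 2 ≤ n)
    (Adj : Matrix (Fin n) (Fin n) ℝ) (hAdj : ∀ i j, 0 ≤ Adj i j)
    (hSC : StronglyConnected Adj) (hWB : WeightBalanced Adj)
    (A : Fin n → Matrix (Fin m) (Fin m) ℝ)
    (α β γ : ℝ) (hα : 0 < α) (hβ : 0 < β) (hγ : 0 < γ) :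
    (∀ xs : Fin n × Fin m → ℝ,
      (rhsX Adj A α β xs 0 = 0 ∧ rhsY Adj A α β γ xs 0 = 0) →
        ∃ xh : Fin m → ℝ, xs = consensus n xh) ∧
    (∀ x y : ℝ → Fin n × Fin m → ℝ,
      (∀ t : ℝ, 0 ≤ t → HasDerivAt x (rhsX Adj A α β (x t) (y t)) t) →
      (∀ t : ℝ, 0 ≤ t → HasDerivAt y (rhsY Adj A α β γ (x t) (y t)) t) →
      ∀ t : ℝ, 0 ≤ t →
        (onesM n m)ᵀ.mulVec (y t - (blkDiag A).mulVec (x t)) =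
          (onesM n m)ᵀ.mulVec (y 0 - (blkDiag A).mulVec (x 0))) := by
  refine ⟨fun xs ⟨hx, _⟩ => ?_, fun x y hx hy t ht => ?_⟩
  · have hL : (bigL m Adj).mulVec xs = 0 := by
      simpa [rhsX, hα.ne'] using hx
    refine ⟨fun k => xs (⟨0, by omega⟩, k), ?_⟩
    ext ⟨i, k⟩
    refine eq_of_lap_mulVec_eq_zero hAdj hSC hWB (u := fun j => xs (j, k)) ?_ i ⟨0, by omega⟩
    ext j
    rw [← bigL_mulVec_apply, hL]
    rfl
  · have hd : ∀ s : ℝ, 0 ≤ s →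
        HasDerivAt (fun s => (onesM n m)ᵀ.mulVec (y s - (blkDiag A).mulVec (x s))) 0 s := by
      intro s hs
      have h := (onesM n m)ᵀ.hasDerivAt_mulVec
        ((hy s hs).sub ((blkDiag A).hasDerivAt_mulVec (hx s hs)))
      rwa [rhsY_sub_blkDiag_mulVec_rhsX, Matrix.mulVec_neg, Matrix.mulVec_smul,
        Matrix.mulVec_mulVec, onesM_transpose_mul_bigL, Matrix.zero_mulVec, smul_zero,
        neg_zero] at h
    exact constant_of_has_deriv_right_zero
      (fun s hs => (hd s hs.1).continuousAt.continuousWithinAt)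
      (fun s hs => (hd s hs.1).hasDerivWithinAt) t ⟨ht, le_rfl⟩
end
end

section
/- Let the digraph be strongly connected and weight-balanced, let α, β, γ > 0, and assume the null space of A is contained in the null space of each A_i. Then along any trajectory (x(t), y(t)) of the distributed dynamics ẋ = −α𝐋x − nβ𝒜ᵀy, ẏ = −α𝒜𝐋x − nβ𝒜𝒜ᵀy − γ𝐋y, for every w = 𝟙_n ⊗ w₀ with A w₀ = 0, the scalar function t ↦ wᵀx(t) is constant. -/
open Matrix

noncomputable section

/-- The columns of the Laplacian sum to zero. -/
theorem sum_lap_apply {n : ℕ} (Adj : Matrix (Fin n) (Fin n) ℝ) (j : Fin n) :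
    ∑ i, lap Adj i j = 0 := by
  simp [lap, Matrix.diagonal_apply, Finset.sum_sub_distrib]

theorem consensus_vecMul_bigL {n m : ℕ} (Adj : Matrix (Fin n) (Fin n) ℝ) (v : Fin m → ℝ) :
    consensus n v ᵥ* bigL m Adj = 0 := by
  ext ⟨j, k⟩
  simp [Matrix.vecMul, dotProduct, consensus, bigL, Fintype.sum_prod_type, Matrix.one_apply,
    ← Finset.mul_sum, sum_lap_apply]

theorem blkDiag_mulVec_consensus {n m : ℕ} (A : Fin n → Matrix (Fin m) (Fin m) ℝ)
    (v : Fin m → ℝ) (i : Fin n) (k : Fin m) :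
    (blkDiag A *ᵥ consensus n v) (i, k) = (A i *ᵥ v) k := by
  simp only [Matrix.mulVec, dotProduct, consensus, blkDiag, Fintype.sum_prod_type]
  rw [Finset.sum_eq_single i]
  · simp
  · intro j _ hj
    simp [hj.symm]
  · simp

/-- The `x`-dynamics is orthogonal to every consensus vector built from a common null vector. -/
theorem consensus_dotProduct_rhsX {n m : ℕ} (Adj : Matrix (Fin n) (Fin n) ℝ)
    (A : Fin n → Matrix (Fin m) (Fin m) ℝ) (α β : ℝ) (v : Fin m → ℝ)
    (hv : ∀ i, A i *ᵥ v = 0) (x y : Fin n × Fin m → ℝ) :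
    consensus n v ⬝ᵥ rhsX Adj A α β x y = 0 := by
  have hA : blkDiag A *ᵥ consensus n v = 0 := by
    ext ⟨i, k⟩
    rw [blkDiag_mulVec_consensus, hv i]
    rfl
  rw [rhsX, dotProduct_sub, dotProduct_neg, dotProduct_smul, dotProduct_smul,
    Matrix.dotProduct_mulVec, Matrix.dotProduct_mulVec, consensus_vecMul_bigL,
    Matrix.vecMul_transpose, hA]
  simp

/-- along any trajectory of the distributed dynamics, assuming
`null(A) ⊆ null(A_i)` for each `i`, for every `w = 𝟙_n ⊗ w₀` with `Aw₀ = 0`,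
the scalar `wᵀx(t)` is constant in time. -/
theorem stmt9 {n m : ℕ} (hn : 2 ≤ n)
    (Adj : Matrix (Fin n) (Fin n) ℝ) (hAdj : ∀ i j, 0 ≤ Adj i j)
    (hSC : StronglyConnected Adj) (hWB : WeightBalanced Adj)
    (A : Fin n → Matrix (Fin m) (Fin m) ℝ)
    (hnull : ∀ v : Fin m → ℝ, (∑ i, A i).mulVec v = 0 → ∀ i, (A i).mulVec v = 0)
    (α β γ : ℝ) (hα : 0 < α) (hβ : 0 < β) (hγ : 0 < γ)
    (x y : ℝ → Fin n × Fin m → ℝ)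
    (hx : ∀ t : ℝ, 0 ≤ t → HasDerivAt x (rhsX Adj A α β (x t) (y t)) t)
    (hy : ∀ t : ℝ, 0 ≤ t → HasDerivAt y (rhsY Adj A α β γ (x t) (y t)) t) :
    ∀ w0 : Fin m → ℝ, (∑ i, A i).mulVec w0 = 0 →
      ∀ t : ℝ, 0 ≤ t → consensus n w0 ⬝ᵥ x t = consensus n w0 ⬝ᵥ x 0 := by
  intro w0 hw0 t ht
  have hderiv : ∀ s : ℝ, 0 ≤ s → HasDerivAt (fun s => consensus n w0 ⬝ᵥ x s) 0 s := by
    intro s hs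
    rw [← consensus_dotProduct_rhsX Adj A α β w0 (hnull w0 hw0) (x s) (y s)]
    exact HasDerivAt.fun_sum fun p _ => (hasDerivAt_pi.mp (hx s hs) p).const_mul _
  exact constant_of_has_deriv_right_zero
    (fun s hs => (hderiv s hs.1).continuousAt.continuousWithinAt)
    (fun s hs => (hderiv s hs.1).hasDerivWithinAt) t ⟨ht, le_rfl⟩
end
end
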